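/- arXiv:2001.04866 — 7 statements merged into one kernel-verified Lean document; each statement's English description precedes it below -/
import Mathlib

section
/- Consider n jobs, all available at a common start time t, to be processed sequentially without idling on a single machine, where job k has processing time p(k) > 0 and deadline d(k). A schedule is a permutation σ of {0,…,n−1} specifying the processing order, under which the job in position m completes at time C_σ(m) = t + Σ_{m' ≤ m} p(σ(m')), and the lateness of the job in position m is L_σ(m) = C_σ(m) − d(σ(m)). If σ is a schedule for which the deadlines d(σ(0)) ≤ d(σ(1)) ≤ … ≤ d(σ(n−1)) are in non-decreasing order (the earliest-due-date schedule), then for every permutation τ of {0,…,n−1}, the maximum lateness under σ is at most the maximum lateness under τ: max_m L_σ(m) ≤ max_m L_τ(m). -/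
/-- Earliest-due-date (EDD) optimality for minimizing maximum lateness
on a single machine.  Jobs `Fin n` with processing times `p`, deadlines `d`, common
release time `t`.  Under a schedule (permutation) `σ`, the job in position `m`
completes at `t + ∑_{m' ≤ m} p (σ m')` and its lateness is this minus `d (σ m)`.
If the deadlines along `σ` are non-decreasing then the maximum lateness of `σ` is
at most that of any other schedule `τ`. -/
theorem edd_minimizes_max_lateness
    (n : ℕ) (hn : 1 ≤ n) (p d : Fin n → ℝ) (hp : ∀ k, 0 < p k) (t : ℝ)
    (σ : Equiv.Perm (Fin n)) (hσ : Monotone fun m => d (σ m))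
    (τ : Equiv.Perm (Fin n)) :
    (Finset.univ.sup' ⟨⟨0, hn⟩, Finset.mem_univ _⟩
        fun m => (t + ∑ m' ∈ Finset.Iic m, p (σ m')) - d (σ m)) ≤
      Finset.univ.sup' ⟨⟨0, hn⟩, Finset.mem_univ _⟩
        fun m => (t + ∑ m' ∈ Finset.Iic m, p (τ m')) - d (τ m) := by
  refine Finset.sup'_le _ _ fun m _ => ?_
  -- `j` is the last position in `τ` of the jobs that `σ` schedules up to position `m`.
  obtain ⟨k, hk, hmax⟩ := Finset.exists_max_image (Finset.Iic m) (fun i => τ.symm (σ i))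
    ⟨m, Finset.mem_Iic.2 le_rfl⟩
  set j := τ.symm (σ k) with hj
  have hd : d (τ j) ≤ d (σ m) := by
    rw [hj, Equiv.apply_symm_apply]
    exact hσ (Finset.mem_Iic.1 hk)
  have hsum : ∑ i ∈ Finset.Iic m, p (σ i) ≤ ∑ i ∈ Finset.Iic j, p (τ i) := by
    calc ∑ i ∈ Finset.Iic m, p (σ i)
        = ∑ i ∈ (Finset.Iic m).map (σ.trans τ.symm).toEmbedding, p (τ i) := by
          simp
      _ ≤ ∑ i ∈ Finset.Iic j, p (τ i) := by
          refine Finset.sum_le_sum_of_subset_of_nonneg ?_ fun i _ _ => (hp _).le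
          intro i hi
          obtain ⟨l, hl, rfl⟩ := Finset.mem_map.1 hi
          exact Finset.mem_Iic.2 (hmax l hl)
  refine le_trans ?_ (Finset.le_sup' _ (Finset.mem_univ j))
  linarith
end

section
/- Let two jobs i and j have processing times p_i > 0 and p_j > 0 and deadlines d_i and d_j with d_i > d_j, and let both be available at time t. If job i is processed first, the latenesses are L_i' = (t + p_i) − d_i and L_j' = (t + p_i + p_j) − d_j; if job j is processed first, the latenesses are L_j = (t + p_j) − d_j and L_i = (t + p_j + p_i) − d_i. Then max(L_j, L_i) ≤ max(L_i', L_j'), i.e., processing the job with the earlier deadline first does not increase the maximum lateness. -/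
/-- Two-job exchange argument.  Jobs `i`, `j` with processing times
`pi, pj > 0` and deadlines `di > dj`, both available at time `t`.  Processing the
job with the earlier deadline (`j`) first does not increase the maximum lateness. -/
theorem two_job_edd_swap
    (t pi pj di dj : ℝ) (hpi : 0 < pi) (hpj : 0 < pj) (hd : di > dj) :
    max ((t + pj) - dj) ((t + pj + pi) - di) ≤
      max ((t + pi) - di) ((t + pi + pj) - dj) := by
  exact le_max_of_le_right (max_le (by linarith) (by linarith))
end

section
/- Consider n jobs with processing times p(k) > 0 and deadlines d(k), all available at time t, processed sequentially without idling according to a permutation σ, with completion time of the job in position m equal to C_σ(m) = t + Σ_{m' ≤ m} p(σ(m')) and lateness L_σ(m) = C_σ(m) − d(σ(m)). Suppose that for some position m with m + 1 < n the deadlines are out of order, d(σ(m)) > d(σ(m+1)). Let σ' be the schedule obtained from σ by swapping the jobs in positions m and m+1. Then the maximum lateness of σ' is at most the maximum lateness of σ: max_r L_{σ'}(r) ≤ max_r L_σ(r). -/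
theorem swap_le_iff_of_covBy {α : Type*} [LinearOrder α] {a b r : α}
    (hab : a ⋖ b) (hr : r ≠ a) (x : α) : Equiv.swap a b x ≤ r ↔ x ≤ r := by
  have hiff : a ≤ r ↔ b ≤ r :=
    ⟨fun h => hab.ge_of_gt (lt_of_le_of_ne h hr.symm), hab.le.trans⟩
  rw [Equiv.swap_apply_def]
  split_ifs with h₁ h₂
  · rw [h₁, hiff]
  · rw [h₂, hiff]
  · rfl

theorem sum_Iic_swap_of_covBy {α M : Type*} [LinearOrder α] [LocallyFiniteOrderBot α]
    [AddCommMonoid M] {a b r : α} (hab : a ⋖ b) (hr : r ≠ a) (f : α → M) :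
    ∑ x ∈ Finset.Iic r, f (Equiv.swap a b x) = ∑ x ∈ Finset.Iic r, f x :=
  Finset.sum_equiv (Equiv.swap a b)
    (fun x => by simp only [Finset.mem_Iic, swap_le_iff_of_covBy hab hr]) fun _ _ => rfl

/-- Adjacent pairwise interchange.  If in schedule `σ` the deadlines
of the jobs in positions `m` and `m+1` are out of order
(`d (σ m) > d (σ (m+1))`), then swapping these two adjacent jobs does not
increase the maximum lateness. -/
theorem adjacent_swap_decreases_max_lateness
    (n : ℕ) (hn : 2 ≤ n) (p d : Fin n → ℝ) (hp : ∀ k, 0 < p k) (t : ℝ)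
    (σ : Equiv.Perm (Fin n)) (m : ℕ) (hm : m + 1 < n)
    (hout : d (σ ⟨m, by omega⟩) > d (σ ⟨m + 1, hm⟩)) :
    (Finset.univ.sup' ⟨⟨0, by omega⟩, Finset.mem_univ _⟩
        fun r => (t + ∑ r' ∈ Finset.Iic r,
            p ((σ * Equiv.swap (⟨m, by omega⟩ : Fin n) ⟨m + 1, hm⟩) r')) -
          d ((σ * Equiv.swap (⟨m, by omega⟩ : Fin n) ⟨m + 1, hm⟩) r)) ≤
      Finset.univ.sup' ⟨⟨0, by omega⟩, Finset.mem_univ _⟩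
        fun r => (t + ∑ r' ∈ Finset.Iic r, p (σ r')) - d (σ r) := by
  have key : ∀ a b : Fin n, a ⋖ b → d (σ b) < d (σ a) → ∀ r, ∃ q,
      (t + ∑ r' ∈ Finset.Iic r, p ((σ * Equiv.swap a b) r')) - d ((σ * Equiv.swap a b) r) ≤
        (t + ∑ r' ∈ Finset.Iic q, p (σ r')) - d (σ q) := by
    intro a b hab hd r
    simp only [Equiv.Perm.mul_apply]
    have hsum : ∀ q, q ≠ a → ∑ r' ∈ Finset.Iic q, p (σ (Equiv.swap a b r')) =
        ∑ r' ∈ Finset.Iic q, p (σ r') :=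
      fun q hq => sum_Iic_swap_of_covBy hab hq fun x => p (σ x)
    by_cases hra : r = a
    · subst hra
      refine ⟨b, ?_⟩
      rw [Equiv.swap_apply_left, ← hsum b hab.lt.ne']
      gcongr
      · exact fun _ _ _ => (hp _).le
      · exact hab.le
    · by_cases hrb : r = b
      · subst hrb
        refine ⟨r, ?_⟩
        rw [Equiv.swap_apply_right, hsum r hra]
        gcongr
      · refine ⟨r, ?_⟩
        rw [Equiv.swap_apply_of_ne_of_ne hra hrb, hsum r hra]
  refine Finset.sup'_le _ _ fun r _ => ?_
  have hcov : (⟨m, by omega⟩ : Fin n) ⋖ ⟨m + 1, hm⟩ := by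
    refine ⟨Fin.mk_lt_mk.2 m.lt_succ_self, fun c h₁ h₂ => ?_⟩
    simp only [Fin.lt_def] at h₁ h₂
    omega
  obtain ⟨q, hq⟩ := key _ _ hcov hout r
  exact hq.trans (Finset.le_sup' (fun r => (t + ∑ r' ∈ Finset.Iic r, p (σ r')) - d (σ r))
    (Finset.mem_univ q))
end

section
/- Let t0 < tm be real numbers, let p0, v0, pm, vm ∈ ℝ, and let u* : ℝ → ℝ be an affine function u*(t) = a·t + b. Let u : ℝ → ℝ be continuous on [t0, tm]. Define for each control w its velocity trajectory v_w(t) = v0 + ∫_{t0}^{t} w(s) ds and position trajectory p_w(t) = p0 + ∫_{t0}^{t} v_w(s) ds. If the trajectories generated by u and by u* satisfy the same boundary conditions, v_u(tm) = v_{u*}(tm) = vm and p_u(tm) = p_{u*}(tm) = pm, then the energy cost of u is at least that of u*: ∫_{t0}^{tm} u(s)² ds ≥ ∫_{t0}^{tm} u*(s)² ds. In other words, among all continuous controls steering the double integrator from state (p0, v0) at time t0 to state (pm, vm) at time tm, an affine control minimizes (1/2)∫ u². -/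
theorem integral_integral_eq_integral_sub_mul {x y : ℝ} (hxy : x ≤ y) {w : ℝ → ℝ}
    (hw : ContinuousOn w (Set.Icc x y)) :
    ∫ s in x..y, ∫ r in x..s, w r = ∫ s in x..y, (y - s) * w s := by
  have hw' : ContinuousOn w (Set.uIcc x y) := by rwa [Set.uIcc_of_le hxy]
  have hint : IntervalIntegrable w MeasureTheory.volume x y := hw'.intervalIntegrable
  have hparts := intervalIntegral.integral_mul_deriv_eq_deriv_mul_of_hasDerivAt
    (u := fun s => y - s) (v := fun s => ∫ r in x..s, w r) (u' := fun _ => -1) (v' := w)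
    (a := x) (b := y) (by fun_prop)
    (intervalIntegral.continuousOn_primitive_interval' hint Set.left_mem_uIcc)
    (fun s _ => by simpa using (hasDerivAt_id s).const_sub y)
    (fun s hs => by
      rw [min_eq_left hxy, max_eq_right hxy] at hs
      have hnhds := Icc_mem_nhds hs.1 hs.2
      refine intervalIntegral.integral_hasDerivAt_right ?_ ?_ (hw.continuousAt hnhds)
      · exact (hw.mono (Set.Icc_subset_Icc_right hs.2.le)).intervalIntegrable_of_Icc hs.1.le
      · exact (hw.mono Set.Ioo_subset_Icc_self).stronglyMeasurableAtFilter isOpen_Ioo s hs)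
    (by simp) hint
  simpa using hparts.symm

theorem integral_affine_mul {x y : ℝ} (hxy : x ≤ y) (v₀ a b : ℝ) {w : ℝ → ℝ}
    (hw : ContinuousOn w (Set.Icc x y)) :
    ∫ s in x..y, (a * s + b) * w s =
      (a * y + b) * (∫ s in x..y, w s) -
        a * ((∫ s in x..y, (v₀ + ∫ r in x..s, w r)) - (y - x) * v₀) := by
  have hw' : ContinuousOn w (Set.uIcc x y) := by rwa [Set.uIcc_of_le hxy]
  have hprim : IntervalIntegrable (fun s => ∫ r in x..s, w r) MeasureTheory.volume x y :=
    (intervalIntegral.continuousOn_primitive_interval' hw'.intervalIntegrable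
      Set.left_mem_uIcc).intervalIntegrable
  rw [intervalIntegral.integral_add intervalIntegrable_const hprim,
    intervalIntegral.integral_const, smul_eq_mul, add_sub_cancel_left,
    integral_integral_eq_integral_sub_mul hxy hw, ← intervalIntegral.integral_const_mul,
    ← intervalIntegral.integral_const_mul, ← intervalIntegral.integral_sub]
  · exact intervalIntegral.integral_congr fun s _ => by ring
  · exact ContinuousOn.intervalIntegrable (by fun_prop)
  · exact ContinuousOn.intervalIntegrable (by fun_prop)


/-- Among all continuous controls steering the double integrator
`ṗ = v, v̇ = u` from `(p0, v0)` at `t0` to `(pm, vm)` at `tm`, an affine control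
`u*(t) = a·t + b` minimizes the energy `∫ u²`. -/
theorem affine_control_minimizes_energy
    (t0 tm p0 v0 pm vm a b : ℝ) (ht : t0 < tm)
    (u : ℝ → ℝ) (hu : ContinuousOn u (Set.Icc t0 tm))
    (hvu : v0 + ∫ s in t0..tm, u s = vm)
    (hvstar : v0 + ∫ s in t0..tm, (a * s + b) = vm)
    (hpu : p0 + ∫ s in t0..tm, (v0 + ∫ r in t0..s, u r) = pm)
    (hpstar : p0 + ∫ s in t0..tm, (v0 + ∫ r in t0..s, (a * r + b)) = pm) :
    (∫ s in t0..tm, (a * s + b) ^ 2) ≤ ∫ s in t0..tm, (u s) ^ 2 := by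
  have hq : ContinuousOn (fun s : ℝ => a * s + b) (Set.Icc t0 tm) := by fun_prop
  have hu' : ContinuousOn u (Set.uIcc t0 tm) := by rwa [Set.uIcc_of_le ht.le]
  have hcross : ∫ s in t0..tm, (a * s + b) * u s = ∫ s in t0..tm, (a * s + b) ^ 2 := by
    simp only [sq]
    rw [integral_affine_mul ht.le v0 a b hu, integral_affine_mul ht.le v0 a b hq,
      add_left_cancel (hvu.trans hvstar.symm), add_left_cancel (hpu.trans hpstar.symm)]
  have hsq : 0 ≤ ∫ s in t0..tm, (u s - (a * s + b)) ^ 2 :=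
    intervalIntegral.integral_nonneg ht.le fun s _ => sq_nonneg _
  have hexpand : ∫ s in t0..tm, (u s - (a * s + b)) ^ 2 =
      (∫ s in t0..tm, u s ^ 2) - 2 * (∫ s in t0..tm, (a * s + b) * u s) +
        ∫ s in t0..tm, (a * s + b) ^ 2 := by
    rw [← intervalIntegral.integral_const_mul, ← intervalIntegral.integral_sub,
      ← intervalIntegral.integral_add]
    · exact intervalIntegral.integral_congr fun s _ => by ring
    all_goals exact ContinuousOn.intervalIntegrable (by fun_prop)
  linarith
end

section
/- Let t0 < tm, let p0, v0, pm, vm ∈ ℝ, let u*(t) = a·t + b be affine, and let u : ℝ → ℝ be continuous on [t0, tm], with both controls steering the double integrator from (p0, v0) at time t0 to (pm, vm) at time tm (i.e., v0 + ∫_{t0}^{tm} u = vm, p0 + ∫_{t0}^{tm} (v0 + ∫_{t0}^{s} u) ds = pm, and likewise for u*). If moreover the energy costs are equal, ∫_{t0}^{tm} u(s)² ds = ∫_{t0}^{tm} u*(s)² ds, then u(t) = u*(t) for all t ∈ [t0, tm]; i.e., the affine control is the unique continuous energy-minimizing control for given boundary conditions. -/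
theorem integral_id_mul_eq_sub_integral_primitive {d : ℝ → ℝ} (hd : Continuous d) (t₀ t₁ : ℝ) :
    ∫ s in t₀..t₁, s * d s = t₁ * (∫ s in t₀..t₁, d s) - ∫ s in t₀..t₁, ∫ r in t₀..s, d r := by
  have h := intervalIntegral.integral_mul_deriv_eq_deriv_mul (a := t₀) (b := t₁)
    (u := fun s => s) (v := fun s => ∫ r in t₀..s, d r) (u' := fun _ => 1) (v' := d)
    (fun x _ => hasDerivAt_id x) (fun x _ => hd.integral_hasStrictDerivAt t₀ x |>.hasDerivAt)
    intervalIntegrable_const (hd.intervalIntegrable _ _)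
  simpa using h

theorem integral_affine_mul_eq_zero {d : ℝ → ℝ} (hd : Continuous d) {t₀ t₁ : ℝ}
    (h₀ : ∫ s in t₀..t₁, d s = 0) (h₁ : ∫ s in t₀..t₁, ∫ r in t₀..s, d r = 0) (a b : ℝ) :
    ∫ s in t₀..t₁, (a * s + b) * d s = 0 := by
  have hid := integral_id_mul_eq_sub_integral_primitive hd t₀ t₁
  have hexp : ∀ s, (a * s + b) * d s = a * (s * d s) + b * d s := fun s => by ring
  simp_rw [hexp]
  rw [intervalIntegral.integral_add
      (Continuous.intervalIntegrable (by fun_prop) _ _)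
      (Continuous.intervalIntegrable (by fun_prop) _ _),
    intervalIntegral.integral_const_mul, intervalIntegral.integral_const_mul, hid, h₀, h₁]
  ring

theorem eq_zero_of_integral_sq_eq_zero {d : ℝ → ℝ} (hd : Continuous d) {t₀ t₁ : ℝ} (ht : t₀ < t₁)
    (h : ∫ s in t₀..t₁, d s ^ 2 = 0) : ∀ s ∈ Set.Icc t₀ t₁, d s = 0 := by
  intro s hs
  by_contra hne
  have hpos := intervalIntegral.integral_pos ht (f := fun s => d s ^ 2) (by fun_prop)
    (fun x _ => sq_nonneg (d x)) ⟨s, hs, by positivity⟩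
  exact hpos.ne' h

/-- Uniqueness of the energy-minimizing control.  If a continuous
control `u` steers the double integrator between the same boundary states as the
affine control `u*(t) = a·t + b` and has the same energy cost, then `u`
coincides with `u*` on `[t0, tm]`. -/
theorem affine_control_unique_energy_minimizer
    (t0 tm p0 v0 pm vm a b : ℝ) (ht : t0 < tm)
    (u : ℝ → ℝ) (hu : ContinuousOn u (Set.Icc t0 tm))
    (hvu : v0 + ∫ s in t0..tm, u s = vm)
    (hvstar : v0 + ∫ s in t0..tm, (a * s + b) = vm)
    (hpu : p0 + ∫ s in t0..tm, (v0 + ∫ r in t0..s, u r) = pm)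
    (hpstar : p0 + ∫ s in t0..tm, (v0 + ∫ r in t0..s, (a * r + b)) = pm)
    (henergy : (∫ s in t0..tm, (u s) ^ 2) = ∫ s in t0..tm, (a * s + b) ^ 2) :
    ∀ s ∈ Set.Icc t0 tm, u s = a * s + b := by
  obtain ⟨w, hw, hwu⟩ : ∃ w : ℝ → ℝ, Continuous w ∧ Set.EqOn u w (Set.Icc t0 tm) :=
    ⟨Set.IccExtend ht.le ((Set.Icc t0 tm).domRestrict u), hu.domRestrict.Icc_extend',
      fun s hs => (Set.IccExtend_of_mem ht.le ((Set.Icc t0 tm).domRestrict u) hs).symm⟩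
  have hprim : ∀ s ∈ Set.Icc t0 tm, ∫ r in t0..s, u r = ∫ r in t0..s, w r := by
    intro s hs
    refine intervalIntegral.integral_congr fun r hr => hwu ?_
    rw [Set.uIcc_of_le hs.1] at hr
    exact ⟨hr.1, hr.2.trans hs.2⟩
  have hppu : ∫ s in t0..tm, (v0 + ∫ r in t0..s, u r)
      = ∫ s in t0..tm, (v0 + ∫ r in t0..s, w r) := by
    refine intervalIntegral.integral_congr fun s hs => ?_
    rw [Set.uIcc_of_le ht.le] at hs
    simp only [hprim s hs]
  have hsq : ∫ s in t0..tm, u s ^ 2 = ∫ s in t0..tm, w s ^ 2 := by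
    refine intervalIntegral.integral_congr fun s hs => ?_
    rw [Set.uIcc_of_le ht.le] at hs
    simp only [hwu hs]
  rw [hprim tm ⟨ht.le, le_rfl⟩] at hvu
  rw [hppu] at hpu
  rw [hsq] at henergy
  have haff : Continuous fun s : ℝ => a * s + b := by fun_prop
  have hd : Continuous fun s => w s - (a * s + b) := by fun_prop
  have hint : ∀ {f : ℝ → ℝ}, Continuous f → ∀ x y : ℝ,
      IntervalIntegrable f MeasureTheory.volume x y := fun hf x y => hf.intervalIntegrable x y
  have hdprim : ∀ s, ∫ r in t0..s, (w r - (a * r + b))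
      = (∫ r in t0..s, w r) - ∫ r in t0..s, (a * r + b) := fun s =>
    intervalIntegral.integral_sub (hint hw _ _) (hint haff _ _)
  have h₀ : ∫ s in t0..tm, (w s - (a * s + b)) = 0 := by
    rw [hdprim]
    linarith
  have hcont : ∀ {f : ℝ → ℝ}, Continuous f → Continuous fun s => v0 + ∫ r in t0..s, f r :=
    fun hf => continuous_const.add (intervalIntegral.continuous_primitive (hint hf) t0)
  have h₁ : ∫ s in t0..tm, ∫ r in t0..s, (w r - (a * r + b)) = 0 := by
    have hsub := intervalIntegral.integral_sub (hint (hcont hw) t0 tm) (hint (hcont haff) t0 tm)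
    simp only [add_sub_add_left_eq_sub] at hsub
    simp_rw [hdprim]
    linarith
  have hcross := integral_affine_mul_eq_zero hd h₀ h₁ a b
  have hdsq : ∫ s in t0..tm, (w s - (a * s + b)) ^ 2 = 0 := by
    have hexp : ∀ s, (w s - (a * s + b)) ^ 2
        = w s ^ 2 - (a * s + b) ^ 2 - 2 * ((a * s + b) * (w s - (a * s + b))) := fun s => by ring
    simp_rw [hexp]
    rw [intervalIntegral.integral_sub (hint (by fun_prop) _ _) (hint (by fun_prop) _ _),
      intervalIntegral.integral_sub (hint (by fun_prop) _ _) (hint (by fun_prop) _ _),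
      intervalIntegral.integral_const_mul, hcross, henergy]
    ring
  intro s hs
  rw [hwu hs]
  exact sub_eq_zero.mp (eq_zero_of_integral_sq_eq_zero hd ht hdsq s hs)
end

section
/- Fix u_max > 0, v_max > 0, and an initial speed v0 with 0 ≤ v0 ≤ v_max. Let dˢ = (v_max² − v0²)/(2·u_max) and let S ≥ dˢ, and define T* = (v_max − v0)/u_max + (S − dˢ)/v_max. Let t0 < t1 and let p : ℝ → ℝ have derivative v on [t0, t1], where v in turn has derivative u on [t0, t1], with p(t0) = 0, p(t1) = S, v(t0) = v0, v(t) ≤ v_max for all t ∈ [t0, t1], and u(t) ≤ u_max for all t ∈ [t0, t1]. Then t1 − t0 ≥ T*. That is, no trajectory of the double integrator respecting the speed limit v_max and acceleration limit u_max can traverse the distance S in time less than T*, the time of the maximal-acceleration-then-cruise profile. -/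
/-- A function that starts below `B` on `[a, b]` and whose derivative there is bounded by that of `B`
stays below `B`. -/
lemma le_of_hasDerivWithinAt_Icc_le {f f' B B' : ℝ → ℝ} {a b : ℝ}
    (hf : ∀ s ∈ Set.Icc a b, HasDerivWithinAt f (f' s) (Set.Icc a b) s)
    (hB : ∀ s, HasDerivAt B (B' s) s) (ha : f a ≤ B a)
    (bound : ∀ s ∈ Set.Icc a b, f' s ≤ B' s) {x : ℝ} (hx : x ∈ Set.Icc a b) : f x ≤ B x :=
  image_le_of_deriv_right_le_deriv_boundary
    (fun s hs => (hf s hs).continuousWithinAt)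
    (fun s hs => (hf s ⟨hs.1, hs.2.le⟩).mono_of_mem_nhdsWithin (Icc_mem_nhdsGE_of_mem hs))
    ha (fun s _ => (hB s).continuousAt.continuousWithinAt)
    (fun s _ => (hB s).hasDerivWithinAt)
    (fun s hs => bound s ⟨hs.1, hs.2.le⟩) hx

/-- Time-optimality lower bound.  No double-integrator trajectory
respecting the speed limit `v_max` and acceleration limit `u_max` can traverse
the distance `S` starting from speed `v0` in time less than
`T* = (v_max − v0)/u_max + (S − dˢ)/v_max`, the duration of the
maximal-acceleration-then-cruise profile, where
`dˢ = (v_max² − v0²)/(2 u_max)`. -/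
theorem time_optimal_lower_bound
    (umax vmax v0 S : ℝ) (humax : 0 < umax) (hvmax : 0 < vmax)
    (hv0 : 0 ≤ v0) (hv0' : v0 ≤ vmax)
    (hS : S ≥ (vmax ^ 2 - v0 ^ 2) / (2 * umax))
    (t0 t1 : ℝ) (ht : t0 < t1) (p v u : ℝ → ℝ)
    (hp : ∀ s ∈ Set.Icc t0 t1, HasDerivWithinAt p (v s) (Set.Icc t0 t1) s)
    (hv : ∀ s ∈ Set.Icc t0 t1, HasDerivWithinAt v (u s) (Set.Icc t0 t1) s)
    (hp0 : p t0 = 0) (hp1 : p t1 = S) (hvinit : v t0 = v0)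
    (hvle : ∀ s ∈ Set.Icc t0 t1, v s ≤ vmax)
    (hule : ∀ s ∈ Set.Icc t0 t1, u s ≤ umax) :
    t1 - t0 ≥ (vmax - v0) / umax
      + (S - (vmax ^ 2 - v0 ^ 2) / (2 * umax)) / vmax := by
  have hv_bound : ∀ s ∈ Set.Icc t0 t1, v s ≤ v0 + umax * (s - t0) := fun s hs =>
    le_of_hasDerivWithinAt_Icc_le (B := fun s => v0 + umax * (s - t0))
      (B' := fun _ => umax) hv
      (fun s => by
        simpa using (((hasDerivAt_id s).sub_const t0).const_mul umax).const_add v0)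
      (by simp [hvinit]) hule hs
  have hp_bound : ∀ s ∈ Set.Icc t0 t1, p s ≤ v0 * (s - t0) + umax / 2 * (s - t0) ^ 2 :=
    fun s hs =>
    le_of_hasDerivWithinAt_Icc_le (B := fun s => v0 * (s - t0) + umax / 2 * (s - t0) ^ 2)
      (B' := fun s => v0 + umax * (s - t0)) hp
      (fun s => by
        have h := (hasDerivAt_id s).sub_const t0
        refine ((h.const_mul v0).add ((h.pow 2).const_mul (umax / 2))).congr_deriv ?_
        simp
        ring)
      (by simp [hp0]) hv_bound hs
  obtain ⟨τ, rfl⟩ : ∃ τ, vmax = v0 + umax * τ := ⟨(vmax - v0) / umax, by field_simp; ring⟩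
  have hτ : 0 ≤ τ := by
    by_contra! h
    nlinarith
  have hd : ((v0 + umax * τ) ^ 2 - v0 ^ 2) / (2 * umax) = v0 * τ + umax / 2 * τ ^ 2 := by
    field_simp
    ring
  have hrise : (v0 + umax * τ - v0) / umax = τ := by
    field_simp
    ring
  rw [hd] at hS
  rw [hd, hrise]
  have hend := hp_bound t1 ⟨ht.le, le_rfl⟩
  rw [hp1] at hend
  have hτT : t0 + τ ≤ t1 := by
    by_contra! h
    have hT : 0 < t1 - t0 := sub_pos.2 ht
    have hlt : t1 - t0 < τ := by linarith
    nlinarith [mul_le_mul_of_nonneg_left hlt.le hv0,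
      mul_lt_mul_of_pos_left (pow_lt_pow_left₀ hlt hT.le two_ne_zero) (half_pos humax)]
  have hsub : Set.Icc (t0 + τ) t1 ⊆ Set.Icc t0 t1 := Set.Icc_subset_Icc_left (by linarith)
  have hcruise : p t1 ≤ p (t0 + τ) + (v0 + umax * τ) * (t1 - (t0 + τ)) :=
    le_of_hasDerivWithinAt_Icc_le (f' := v) (B' := fun _ => v0 + umax * τ)
      (B := fun s => p (t0 + τ) + (v0 + umax * τ) * (s - (t0 + τ)))
      (fun s hs => (hp s (hsub hs)).mono hsub)
      (fun s => by
        simpa using (((hasDerivAt_id s).sub_const (t0 + τ)).const_mul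
          (v0 + umax * τ)).const_add (p (t0 + τ)))
      (by simp) (fun s hs => hvle s (hsub hs)) ⟨hτT, le_rfl⟩
  have hswitch := hp_bound (t0 + τ) ⟨by linarith, hτT⟩
  rw [add_sub_cancel_left] at hswitch
  have hquot : (S - (v0 * τ + umax / 2 * τ ^ 2)) / (v0 + umax * τ) ≤ t1 - (t0 + τ) := by
    rw [div_le_iff₀ hvmax]
    linarith
  linarith
end

section
/- Fix u_max > 0, v_max > 0, and 0 ≤ v0 ≤ v_max, and set tˢ = (v_max − v0)/u_max, dˢ = (v_max² − v0²)/(2·u_max). Let S ≥ dˢ and T* = tˢ + (S − dˢ)/v_max. Define on [0, T*] the trajectory p(t) = v0·t + (1/2)u_max·t² for t ∈ [0, tˢ] and p(t) = dˢ + v_max·(t − tˢ) for t ∈ [tˢ, T*], with velocity v(t) = v0 + u_max·t for t ∈ [0, tˢ] and v(t) = v_max for t ∈ [tˢ, T*]. Then p is differentiable on [0, T*] with derivative v, v is the velocity of a control taking value u_max on [0, tˢ] and 0 on [tˢ, T*], the constraints p(0) = 0, v(0) = v0, and v(t) ≤ v_max hold for all t ∈ [0, T*], and p(T*) = S. Hence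 the minimum travel time T* in the time-optimal control problem is attained by the maximal-acceleration-then-cruise control. -/
/-- Two differentiable functions that agree to first order at `c` glue to a differentiable
function. -/
theorem hasDerivAt_ite_le {f g f' g' : ℝ → ℝ} {c : ℝ}
    (hf : ∀ x, HasDerivAt f (f' x) x) (hg : ∀ x, HasDerivAt g (g' x) x)
    (hfg : f c = g c) (hfg' : f' c = g' c) (x : ℝ) :
    HasDerivAt (fun s => if s ≤ c then f s else g s) (if x ≤ c then f' x else g' x) x := by
  rcases lt_trichotomy x c with hx | rfl | hx
  · rw [if_pos hx.le]
    refine (hf x).congr_of_eventuallyEq ?_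
    filter_upwards [Iio_mem_nhds hx] with y hy
    exact if_pos (le_of_lt hy)
  · rw [if_pos le_rfl, ← hasDerivWithinAt_univ, ← Set.Iic_union_Ici (a := x)]
    refine HasDerivWithinAt.union ?_ ?_
    · exact (hf x).hasDerivWithinAt.congr (fun y hy => if_pos hy) (if_pos le_rfl)
    · rw [hfg']
      refine (hg x).hasDerivWithinAt.congr (fun y hy => ?_) ((if_pos le_rfl).trans hfg)
      rcases (show x ≤ y from hy).eq_or_lt with rfl | hy
      · exact (if_pos le_rfl).trans hfg
      · exact if_neg hy.not_ge
  · rw [if_neg hx.not_ge]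
    refine (hg x).congr_of_eventuallyEq ?_
    filter_upwards [Ioi_mem_nhds hx] with y hy
    exact if_neg (not_le_of_gt hy)

/-- The integral of a step function that drops from `a` to `0` at `c ≥ 0`. -/
theorem intervalIntegral_ite_le_const_zero (a : ℝ) {c s : ℝ} (hc : 0 ≤ c) (hs : 0 ≤ s) :
    ∫ r in (0 : ℝ)..s, (if r ≤ c then a else 0) = a * min s c := by
  have h : (fun r : ℝ => if r ≤ c then a else 0) = (Set.Iic c).indicator fun _ => a := by
    ext r
    simp [Set.indicator_apply]
  rw [h, intervalIntegral.integral_of_le hs, MeasureTheory.setIntegral_indicator measurableSet_Iic,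
    Set.Ioc_inter_Iic, MeasureTheory.setIntegral_const, Real.volume_real_Ioc_of_le (le_min hs hc),
    sub_zero, smul_eq_mul, mul_comm]

/-- The minimum travel time `T* = tˢ + (S − dˢ)/v_max` is attained
by the maximal-acceleration-then-cruise profile: accelerate at `u_max` on
`[0, tˢ]`, then cruise at `v_max` on `[tˢ, T*]`.  Here
`tˢ = (v_max − v0)/u_max` and `dˢ = (v_max² − v0²)/(2 u_max)`. -/
theorem time_optimal_profile_attains
    (umax vmax v0 S : ℝ) (humax : 0 < umax) (hvmax : 0 < vmax)
    (hv0 : 0 ≤ v0) (hv0' : v0 ≤ vmax)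
    (hS : S ≥ (vmax ^ 2 - v0 ^ 2) / (2 * umax)) :
    let ts := (vmax - v0) / umax
    let ds := (vmax ^ 2 - v0 ^ 2) / (2 * umax)
    let Tstar := ts + (S - ds) / vmax
    let p : ℝ → ℝ := fun s =>
      if s ≤ ts then v0 * s + (1/2) * umax * s ^ 2 else ds + vmax * (s - ts)
    let v : ℝ → ℝ := fun s => if s ≤ ts then v0 + umax * s else vmax
    let u : ℝ → ℝ := fun s => if s ≤ ts then umax else 0
    (∀ s ∈ Set.Icc (0 : ℝ) Tstar,
        HasDerivWithinAt p (v s) (Set.Icc (0 : ℝ) Tstar) s) ∧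
    (∀ s ∈ Set.Icc (0 : ℝ) Tstar, v s = v0 + ∫ r in (0 : ℝ)..s, u r) ∧
    p 0 = 0 ∧ v 0 = v0 ∧
    (∀ s ∈ Set.Icc (0 : ℝ) Tstar, v s ≤ vmax) ∧
    p Tstar = S := by
  intro ts ds Tstar p v u
  have hts : 0 ≤ ts := div_nonneg (sub_nonneg.2 hv0') humax.le
  have hvts : v0 + umax * ts = vmax := by
    simp only [ts]
    field_simp
    ring
  have hds : v0 * ts + (1/2) * umax * ts ^ 2 = ds := by
    simp only [ts, ds]
    field_simp
    ring
  refine ⟨fun s _ => ?_, fun s hs => ?_, ?_, ?_, fun s _ => ?_, ?_⟩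
  · refine (hasDerivAt_ite_le (f' := fun x => v0 + umax * x) (g' := fun _ => vmax)
      (fun x => ?_) (fun x => ?_) ?_ hvts s).hasDerivWithinAt
    · refine (((hasDerivAt_id x).const_mul v0).add
        (((hasDerivAt_id x).pow 2).const_mul ((1/2) * umax))).congr_deriv ?_
      simp only [id, Nat.cast_ofNat]
      ring
    · simpa using (((hasDerivAt_id x).sub_const ts).const_mul vmax).const_add ds
    · rw [hds, sub_self, mul_zero, add_zero]
  · rw [intervalIntegral_ite_le_const_zero umax hts hs.1]
    by_cases h : s ≤ ts
    · rw [min_eq_left h]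
      exact if_pos h
    · rw [min_eq_right (le_of_not_ge h), hvts]
      exact if_neg h
  · simp [p, hts]
  · simp [v, hts]
  · by_cases h : s ≤ ts
    · calc v s = v0 + umax * s := if_pos h
        _ ≤ v0 + umax * ts := by gcongr
        _ = vmax := hvts
    · exact (if_neg h).le
  · by_cases h : Tstar ≤ ts
    · have hq : 0 ≤ (S - ds) / vmax := div_nonneg (sub_nonneg.2 hS) hvmax.le
      have hq0 : (S - ds) / vmax = 0 := by
        have : ts + (S - ds) / vmax ≤ ts := h
        linarith
      have hT : Tstar = ts := by simp only [Tstar, hq0, add_zero]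
      have hSd : S = ds := sub_eq_zero.1 ((div_eq_zero_iff.1 hq0).resolve_right hvmax.ne')
      rw [hT, hSd, ← hds]
      exact if_pos le_rfl
    · refine (if_neg h).trans ?_
      rw [show Tstar - ts = (S - ds) / vmax from add_sub_cancel_left _ _,
        mul_div_cancel₀ _ hvmax.ne', add_sub_cancel]
end
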